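/- Let (d_n, k_n) be a sequence of admissible dimension pairs with d_n → ∞ and d_n − k_n → ∞. For each n let μ_n be a probability measure on ℝ whose characteristic function is φ_n(t) = exp( σ_{d_n,k_n}^{-2} ∫_0^1 ( e^{itx} − 1 − itx ) f_{d_n,k_n}(x) dx ) for all t ∈ ℝ. Then μ_n converges weakly to the standard Gaussian measure N(0,1) on ℝ as n → ∞. -/

import Mathlib

open MeasureTheory ProbabilityTheory Filter

/-- The characteristic function of a measure on `ℝ`. -/
noncomputable def charFn (μ : Measure ℝ) (t : ℝ) : ℂ :=
  ∫ x, Complex.exp (Complex.I * t * x) ∂μ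

/-- The Lévy density `f_{d,k}(x) = (ω_{d−k}/(k−1)) x^{−1−(d−1)/(k−1)} (1−x^{2/(k−1)})^{(d−k)/2−1}`
on `(0,1)`, where `ω_b = 2π^{b/2}/Γ(b/2)`. -/
noncomputable def levyDensity (d k : ℕ) (x : ℝ) : ℝ :=
  2 * Real.pi ^ (((d : ℝ) - k) / 2) / Real.Gamma (((d : ℝ) - k) / 2) / ((k : ℝ) - 1) *
    x ^ (-1 - ((d : ℝ) - 1) / ((k : ℝ) - 1)) *
    (1 - x ^ (2 / ((k : ℝ) - 1))) ^ (((d : ℝ) - k) / 2 - 1)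

/-- The variance `σ_{d,k}² = ∫_0^1 x² f_{d,k}(x) dx` of the limit random variable `Z_{d,k}`. -/
noncomputable def sigmaSqHyp (d k : ℕ) : ℝ :=
  ∫ x in Set.Ioo (0 : ℝ) 1, x ^ 2 * levyDensity d k x

/-- `σ_{d,k} = (σ_{d,k}²)^{1/2}`. -/
noncomputable def sigmaHyp (d k : ℕ) : ℝ :=
  Real.sqrt (sigmaSqHyp d k)

theorem integrableOn_rpow_mul_one_sub_rpow {a b : ℝ} (ha : 0 < a) (hb : 0 < b) :
    IntegrableOn (fun x : ℝ => x ^ (a - 1) * (1 - x) ^ (b - 1)) (Set.Ioo 0 1) := by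
  have h := Complex.betaIntegral_convergent (u := a) (v := b) (by simpa) (by simpa)
  rw [intervalIntegrable_iff_integrableOn_Ioo_of_le zero_le_one] at h
  refine IntegrableOn.congr_fun (Integrable.re h) (fun x hx => ?_) measurableSet_Ioo
  norm_cast
  rw [← Complex.ofReal_cpow hx.1.le, ← Complex.ofReal_cpow (by linarith [hx.2]),
    ← Complex.ofReal_mul]
  exact Complex.ofReal_re _

theorem integral_rpow_mul_one_sub_rpow {a b : ℝ} (ha : 0 < a) (hb : 0 < b) :
    ∫ x in Set.Ioo (0 : ℝ) 1, x ^ (a - 1) * (1 - x) ^ (b - 1) = beta a b := by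
  have h := Complex.betaIntegral_convergent (u := a) (v := b) (by simpa) (by simpa)
  rw [intervalIntegrable_iff_integrableOn_Ioo_of_le zero_le_one] at h
  rw [beta_eq_betaIntegralReal a b ha hb, Complex.betaIntegral,
    intervalIntegral.integral_of_le zero_le_one, integral_Ioc_eq_integral_Ioo,
    ← RCLike.re_to_complex, ← integral_re h]
  refine setIntegral_congr_fun measurableSet_Ioo fun x hx => ?_
  norm_cast
  rw [← Complex.ofReal_cpow hx.1.le, ← Complex.ofReal_cpow (by linarith [hx.2]),
    ← Complex.ofReal_mul]
  exact (Complex.ofReal_re _).symm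

theorem beta_anti_left {a a' b : ℝ} (ha : 0 < a) (hb : 0 < b) (h : a ≤ a') :
    beta a' b ≤ beta a b := by
  rw [← integral_rpow_mul_one_sub_rpow ha hb,
    ← integral_rpow_mul_one_sub_rpow (ha.trans_le h) hb]
  refine setIntegral_mono_on (integrableOn_rpow_mul_one_sub_rpow (ha.trans_le h) hb)
    (integrableOn_rpow_mul_one_sub_rpow ha hb) measurableSet_Ioo fun x hx => ?_
  have := Real.rpow_nonneg (sub_nonneg.2 hx.2.le) (b - 1)
  exact mul_le_mul_of_nonneg_right
    (Real.rpow_le_rpow_of_exponent_ge hx.1 hx.2.le (by linarith)) this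

theorem beta_add_one_left {a b : ℝ} (ha : 0 < a) (hb : 0 < b) :
    beta (a + 1) b = a / (a + b) * beta a b := by
  have := (Real.Gamma_pos_of_pos (add_pos ha hb)).ne'
  rw [beta, beta, show a + 1 + b = (a + b) + 1 by ring, Real.Gamma_add_one ha.ne',
    Real.Gamma_add_one (add_pos ha hb).ne']
  field_simp

theorem beta_add_natCast_left_le {a b s : ℝ} (ha : 0 < a) (hb : 0 < b) (hs : a + b ≤ s) (j : ℕ)
    (hj : j ≤ s) : beta (a + j) b ≤ Real.exp (-(b / (2 * s))) ^ j * beta a b := by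
  induction j with
  | zero => simp
  | succ j ih =>
    push_cast at hj ⊢
    have hj0 : (0 : ℝ) ≤ j := j.cast_nonneg
    have haj : 0 < a + j := by positivity
    have hle : (a + j) / (a + j + b) ≤ Real.exp (-(b / (2 * s))) := by
      refine le_trans ?_ (Real.add_one_le_exp _)
      have h1 : (a + j) / (a + j + b) = -(b / (a + j + b)) + 1 := by field_simp; ring
      have h2 : b / (2 * s) ≤ b / (a + j + b) :=
        div_le_div_of_nonneg_left hb.le (by positivity) (by linarith)
      linarith
    rw [← add_assoc, beta_add_one_left haj hb, pow_succ', mul_assoc]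
    exact mul_le_mul hle (ih (by linarith)) (beta_pos haj hb).le (Real.exp_pos _).le

theorem beta_add_left_le {a b s : ℝ} (ha : 0 < a) (hb : 0 < b) (hs : a + b ≤ s) (hs1 : 1 ≤ s) :
    beta (a + s) b ≤ Real.exp (-(b / 4)) * beta a b := by
  have hfl : (⌊s⌋₊ : ℝ) ≤ s := Nat.floor_le (by linarith)
  have hfl' : s < ⌊s⌋₊ + 1 := Nat.lt_floor_add_one s
  have hfl1 : (1 : ℝ) ≤ ⌊s⌋₊ := by exact_mod_cast (Nat.one_le_floor_iff s).2 hs1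
  refine (beta_anti_left (by positivity) hb (by gcongr)).trans
    ((beta_add_natCast_left_le ha hb hs ⌊s⌋₊ hfl).trans ?_)
  refine mul_le_mul_of_nonneg_right ?_ (beta_pos ha hb).le
  rw [← Real.exp_nat_mul, Real.exp_le_exp, mul_neg, neg_le_neg_iff,
    ← mul_div_assoc, div_le_div_iff₀ (by norm_num) (by linarith)]
  nlinarith

/-- The substitution `u = x ^ (2 / (k - 1))` turns the moments of the Lévy density into Beta
integrals. -/
theorem levyDensity_moment {d k : ℕ} (hk : 1 < k) (hkd : k < d) (p : ℕ)
    (hp : (d : ℝ) - 1 < p * ((k : ℝ) - 1)) :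
    IntegrableOn (fun x => x ^ p * levyDensity d k x) (Set.Ioo 0 1) ∧
      ∫ x in Set.Ioo (0 : ℝ) 1, x ^ p * levyDensity d k x =
        Real.pi ^ (((d : ℝ) - k) / 2) / Real.Gamma (((d : ℝ) - k) / 2) *
          beta ((p * ((k : ℝ) - 1) - (d - 1)) / 2) (((d : ℝ) - k) / 2) := by
  have hm : (0 : ℝ) < (k : ℝ) - 1 := sub_pos.2 (by exact_mod_cast hk)
  have hb : 0 < ((d : ℝ) - k) / 2 := half_pos (sub_pos.2 (by exact_mod_cast hkd))
  set m : ℝ := (k : ℝ) - 1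
  have ha : 0 < (p * m - (d - 1)) / 2 := by linarith
  set b : ℝ := ((d : ℝ) - k) / 2
  set a : ℝ := (p * m - (d - 1)) / 2 with ha_def
  set C : ℝ := Real.pi ^ b / Real.Gamma b
  have hq : 0 < 2 / m := by positivity
  set g : ℝ → ℝ := (Set.Ioo 0 1).indicator fun u => u ^ (a - 1) * (1 - u) ^ (b - 1)
  have hIoo : Set.Ioi (0 : ℝ) ∩ Set.Ioo 0 1 = Set.Ioo 0 1 :=
    Set.inter_eq_right.2 fun x hx => hx.1
  have key : Set.EqOn (fun x => C * ((|2 / m| * x ^ (2 / m - 1)) • g (x ^ (2 / m))))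
      ((Set.Ioo 0 1).indicator fun x => x ^ p * levyDensity d k x) (Set.Ioi 0) := by
    intro x hx
    have hx : 0 < x := hx
    by_cases hx1 : x < 1
    · have hu : x ^ (2 / m) ∈ Set.Ioo (0 : ℝ) 1 :=
        ⟨Real.rpow_pos_of_pos hx _, Real.rpow_lt_one hx.le hx1 hq⟩
      have hpow : x ^ p * x ^ (-1 - ((d : ℝ) - 1) / m) =
          x ^ (2 / m - 1) * (x ^ (2 / m)) ^ (a - 1) := by
        rw [← Real.rpow_natCast, ← Real.rpow_mul hx.le, ← Real.rpow_add hx, ← Real.rpow_add hx]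
        congr 1
        rw [ha_def]
        field_simp
        ring
      simp only [g, Set.indicator_of_mem hu, Set.indicator_of_mem (Set.mem_Ioo.2 ⟨hx, hx1⟩),
        abs_of_pos hq, smul_eq_mul, levyDensity]
      change _ = x ^ p * (2 * Real.pi ^ b / Real.Gamma b / m * x ^ (-1 - ((d : ℝ) - 1) / m) *
        (1 - x ^ (2 / m)) ^ (b - 1))
      calc _ = C * (2 / m) * (x ^ (2 / m - 1) * (x ^ (2 / m)) ^ (a - 1)) *
            (1 - x ^ (2 / m)) ^ (b - 1) := by ring
        _ = _ := by rw [← hpow]; simp only [C]; ring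
    · have hu : x ^ (2 / m) ∉ Set.Ioo (0 : ℝ) 1 := fun h =>
        absurd h.2 (not_lt.2 (Real.one_le_rpow (not_lt.1 hx1) hq.le))
      simp [g, Set.indicator_of_notMem hu, hx1]
  constructor
  · have h : IntegrableOn g (Set.Ioi 0) :=
      (integrable_indicator_iff measurableSet_Ioo).2
        (integrableOn_rpow_mul_one_sub_rpow ha hb) |>.integrableOn
    have h2 := (((integrableOn_Ioi_comp_rpow_iff g hq.ne').2 h).const_mul C)
    have h3 : IntegrableOn _ (Set.Ioi (0 : ℝ)) := IntegrableOn.congr_fun h2 key measurableSet_Ioi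
    rw [IntegrableOn, integrable_indicator_iff measurableSet_Ioo, IntegrableOn,
      Measure.restrict_restrict measurableSet_Ioo, Set.inter_comm, hIoo] at h3
    exact h3
  · have h := integral_comp_rpow_Ioi g hq.ne'
    rw [← integral_rpow_mul_one_sub_rpow ha hb]
    have h3 := setIntegral_congr_fun (μ := volume) measurableSet_Ioi key
    rw [setIntegral_indicator measurableSet_Ioo, hIoo, integral_const_mul, h,
      setIntegral_indicator measurableSet_Ioo, hIoo] at h3
    exact h3.symm

theorem levyDensity_nonneg {d k : ℕ} (hk : 1 < k) (hkd : k < d) {x : ℝ}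
    (hx : x ∈ Set.Ioo (0 : ℝ) 1) : 0 ≤ levyDensity d k x := by
  have hm : (0 : ℝ) < (k : ℝ) - 1 := sub_pos.2 (by exact_mod_cast hk)
  have hb : 0 < ((d : ℝ) - k) / 2 := half_pos (sub_pos.2 (by exact_mod_cast hkd))
  have h1 : 0 ≤ 1 - x ^ (2 / ((k : ℝ) - 1)) :=
    sub_nonneg.2 (Real.rpow_le_one hx.1.le hx.2.le (by positivity))
  have := Real.Gamma_pos_of_pos hb
  have := hx.1
  unfold levyDensity
  positivity

theorem norm_cexp_sub_quadratic_le (t : ℝ) {x : ℝ} (hx : x ∈ Set.Ioo (0 : ℝ) 1) :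
    ‖Complex.exp (Complex.I * t * x) - 1 - Complex.I * t * x + t ^ 2 / 2 * x ^ 2‖ ≤
      |t| ^ 3 * Real.exp |t| * x ^ 3 := by
  have h := Complex.norm_exp_sub_sum_le_norm_mul_exp (Complex.I * t * x) 3
  have hn : ‖Complex.I * t * x‖ = |t| * x := by simp [abs_of_pos hx.1]
  have hsum : Complex.exp (Complex.I * t * x) -
      ∑ j ∈ Finset.range 3, (Complex.I * t * x) ^ j / (j.factorial : ℂ) =
      Complex.exp (Complex.I * t * x) - 1 - Complex.I * t * x + t ^ 2 / 2 * x ^ 2 := by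
    simp [Finset.sum_range_succ, mul_pow, Nat.factorial]
    ring
  rw [hsum, hn] at h
  refine h.trans ?_
  have : Real.exp (|t| * x) ≤ Real.exp |t| :=
    Real.exp_le_exp.2 (mul_le_of_le_one_right (abs_nonneg t) hx.2.le)
  calc (|t| * x) ^ 3 * Real.exp (|t| * x) ≤ (|t| * x) ^ 3 * Real.exp |t| := by
        have := hx.1
        gcongr
    _ = _ := by ring

theorem norm_levyExponent_add_le {d k : ℕ} (hkd : k < d) (hdk : d + 1 < 2 * k) (t : ℝ) :
    ‖(((sigmaSqHyp d k : ℂ))⁻¹ * ∫ x in Set.Ioo (0 : ℝ) 1,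
        (Complex.exp (Complex.I * t * x) - 1 - Complex.I * t * x) * (levyDensity d k x : ℂ)) +
      t ^ 2 / 2‖ ≤ |t| ^ 3 * Real.exp |t| * Real.exp (-(((d : ℝ) - k) / 8)) := by
  have hk : 3 ≤ k := by lia
  have hkR : (3 : ℝ) ≤ k := by exact_mod_cast hk
  have hkdR : (k : ℝ) < d := by exact_mod_cast hkd
  have hdkR : (d : ℝ) + 1 < 2 * k := by exact_mod_cast hdk
  obtain ⟨hi2, hv2⟩ := levyDensity_moment (by lia) hkd 2 (by push_cast; linarith)
  obtain ⟨hi3, hv3⟩ := levyDensity_moment (by lia) hkd 3 (by push_cast; linarith)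
  have hb : 0 < ((d : ℝ) - k) / 2 := by linarith
  have ha : 0 < ((2 : ℕ) * ((k : ℝ) - 1) - (d - 1)) / 2 := by push_cast; linarith
  have hC : 0 < Real.pi ^ (((d : ℝ) - k) / 2) / Real.Gamma (((d : ℝ) - k) / 2) :=
    div_pos (Real.rpow_pos_of_pos Real.pi_pos _) (Real.Gamma_pos_of_pos hb)
  have hσ : 0 < sigmaSqHyp d k := by
    rw [sigmaSqHyp, hv2]
    exact mul_pos hC (beta_pos ha hb)
  have h32 : ∫ x in Set.Ioo (0 : ℝ) 1, x ^ 3 * levyDensity d k x ≤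
      Real.exp (-(((d : ℝ) - k) / 8)) * sigmaSqHyp d k := by
    rw [sigmaSqHyp, hv2, hv3, mul_left_comm]
    refine mul_le_mul_of_nonneg_left ?_ hC.le
    have := beta_add_left_le (s := ((k : ℝ) - 1) / 2) ha hb (by push_cast; linarith) (by linarith)
    convert! this using 2
    · push_cast; ring
    · ring_nf
  set R : ℝ → ℂ := fun x => (Complex.exp (Complex.I * t * x) - 1 - Complex.I * t * x +
    t ^ 2 / 2 * x ^ 2) * (levyDensity d k x : ℂ)
  have hRle : ∀ x ∈ Set.Ioo (0 : ℝ) 1,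
      ‖R x‖ ≤ |t| ^ 3 * Real.exp |t| * (x ^ 3 * levyDensity d k x) := by
    intro x hx
    have hnn := levyDensity_nonneg (by lia) hkd hx
    simp only [R, norm_mul, Complex.norm_real, Real.norm_of_nonneg hnn]
    rw [← mul_assoc]
    exact mul_le_mul_of_nonneg_right (norm_cexp_sub_quadratic_le t hx) hnn
  have hRm : Measurable R := by
    unfold R levyDensity
    fun_prop
  have hRi : IntegrableOn R (Set.Ioo 0 1) :=
    Integrable.mono' (hi3.const_mul _) hRm.aestronglyMeasurable
      (ae_restrict_of_forall_mem measurableSet_Ioo hRle)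
  have hsplit : ∫ x in Set.Ioo (0 : ℝ) 1,
        (Complex.exp (Complex.I * t * x) - 1 - Complex.I * t * x) * (levyDensity d k x : ℂ) =
      (∫ x in Set.Ioo (0 : ℝ) 1, R x) - t ^ 2 / 2 * sigmaSqHyp d k := by
    rw [sigmaSqHyp, ← integral_complex_ofReal, ← integral_const_mul, ← integral_sub hRi]
    · congr 1 with x
      simp only [R]
      push_cast
      ring
    · exact hi2.ofReal.const_mul _
  have hRint : ‖∫ x in Set.Ioo (0 : ℝ) 1, R x‖ ≤
      |t| ^ 3 * Real.exp |t| * (Real.exp (-(((d : ℝ) - k) / 8)) * sigmaSqHyp d k) := by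
    refine (norm_integral_le_of_norm_le (hi3.const_mul _)
      (ae_restrict_of_forall_mem measurableSet_Ioo hRle)).trans ?_
    rw [integral_const_mul]
    gcongr
  have hσC : (sigmaSqHyp d k : ℂ) ≠ 0 := by exact_mod_cast hσ.ne'
  have heq : ((sigmaSqHyp d k : ℂ))⁻¹ * ((∫ x in Set.Ioo (0 : ℝ) 1, R x) -
      t ^ 2 / 2 * sigmaSqHyp d k) + t ^ 2 / 2 =
      ((sigmaSqHyp d k : ℂ))⁻¹ * ∫ x in Set.Ioo (0 : ℝ) 1, R x := by
    field_simp
    ring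
  rw [hsplit, heq, norm_mul, norm_inv, Complex.norm_real, Real.norm_of_nonneg hσ.le,
    inv_mul_le_iff₀ hσ]
  linarith

theorem charFn_eq_charFun (μ : Measure ℝ) (t : ℝ) : charFn μ t = charFun μ t := by
  rw [charFn, charFun_apply_real]
  congr 1 with x
  ring_nf

/-- Diverging-codimension Gaussian limit: if `(d_n,k_n)` is admissible with `d_n → ∞` and
`d_n − k_n → ∞`, then the probability measures `μ n` with characteristic function
`exp(σ_{d_n,k_n}^{-2} ∫_0^1 (e^{itx} − 1 − itx) f_{d_n,k_n}(x) dx)` converge weakly to the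
standard Gaussian measure `N(0,1)`. -/
theorem hyperbolic_diverging_codimension_CLT (d k : ℕ → ℕ)
    (hadm : ∀ n, 1 ≤ k n ∧ k n + 1 ≤ d n ∧ d n + 1 < 2 * k n)
    (hd : Tendsto d atTop atTop)
    (hcodim : Tendsto (fun n => d n - k n) atTop atTop)
    (μ : ℕ → ProbabilityMeasure ℝ)
    (hchar : ∀ n, ∀ t : ℝ, charFn (μ n) t =
      Complex.exp (((sigmaSqHyp (d n) (k n) : ℂ))⁻¹ *
        ∫ x in Set.Ioo (0 : ℝ) 1,
          (Complex.exp (Complex.I * t * x) - 1 - Complex.I * t * x) *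
            (levyDensity (d n) (k n) x : ℂ))) :
    Tendsto μ atTop (nhds ⟨gaussianReal 0 1, inferInstance⟩) := by
  refine ProbabilityMeasure.tendsto_iff_tendsto_charFun.2 fun t => ?_
  rw [ProbabilityMeasure.coe_mk, charFun_gaussianReal]
  refine Tendsto.congr (fun n => (hchar n t).symm.trans (charFn_eq_charFun _ t)) ?_
  refine (Complex.continuous_exp.tendsto _).comp ?_
  have hc : Tendsto (fun n => ((d n : ℝ) - k n)) atTop atTop := by
    refine (tendsto_natCast_atTop_atTop.comp hcodim).congr fun n => ?_
    have : k n ≤ d n := by have := hadm n; lia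
    simp [Nat.cast_sub this]
  have hb : Tendsto (fun n => |t| ^ 3 * Real.exp |t| * Real.exp (-(((d n : ℝ) - k n) / 8)))
      atTop (nhds 0) := by
    rw [← mul_zero (|t| ^ 3 * Real.exp |t|)]
    exact (Real.tendsto_exp_neg_atTop_nhds_zero.comp
      (hc.atTop_div_const (by norm_num))).const_mul _
  rw [tendsto_iff_norm_sub_tendsto_zero]
  refine squeeze_zero (fun _ => norm_nonneg _) (fun n => ?_) hb
  obtain ⟨-, h1, h2⟩ := hadm n
  have h := norm_levyExponent_add_le (by lia) h2 t
  rw [← sub_neg_eq_add] at h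
  simpa using h
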